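/- arXiv:1901.02160 — 2 statements merged into one kernel-verified Lean document; each statement's English description precedes it below -/
import Mathlib

section
/- Let v₃, v₄, v₅, v₆ ∈ e₃^⊥ and let P = conv{e₃, −e₃, 0, v₃, v₄, v₅, v₆} be a strange polytope, i.e. Q = conv{0, v₃, v₄, v₅, v₆} is two-dimensional. If ‖v_i‖ ≥ 17 for some i ∈ {3,4,5,6}, then S(P)^3 / V(P)^2 > 344. -/
open scoped MeasureTheory

noncomputable def vol (K : Set (EuclideanSpace ℝ (Fin 3))) : ℝ :=
  (MeasureTheory.volume K).toReal

noncomputable def sArea (K : Set (EuclideanSpace ℝ (Fin 3))) : ℝ :=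
  (μH[2] (frontier K)).toReal

noncomputable def e (i : Fin 3) : EuclideanSpace ℝ (Fin 3) :=
  EuclideanSpace.single i 1

open MeasureTheory Set Topology
open scoped Pointwise

/-! ### Hausdorff measure of the boundary of a polytope -/

lemma hausdorffMeasure_two_convexHull_triple_lt_top (p : Fin 3 → EuclideanSpace ℝ (Fin 3)) :
    μH[2] (convexHull ℝ (range p)) < ⊤ := by
  let f : ℝ × ℝ → EuclideanSpace ℝ (Fin 3) :=
    fun t => p 0 + (t.1 • (p 1 - p 0) + t.2 • (p 2 - p 0))
  let g : ℝ × ℝ →L[ℝ] EuclideanSpace ℝ (Fin 3) :=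
    (ContinuousLinearMap.fst ℝ ℝ ℝ).smulRight (p 1 - p 0) +
      (ContinuousLinearMap.snd ℝ ℝ ℝ).smulRight (p 2 - p 0)
  have hf : LipschitzWith ‖g‖₊ f := by
    have := g.lipschitz
    intro x y
    simpa [f, g] using this x y
  have hsub : convexHull ℝ (range p) ⊆ f '' (Icc 0 1 ×ˢ Icc 0 1) := by
    have hconv : Convex ℝ (f '' (Icc 0 1 ×ˢ Icc 0 1)) := by
      have := (((convex_Icc (0 : ℝ) 1).prod (convex_Icc (0 : ℝ) 1)).linear_image
        g.toLinearMap).translate (p 0)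
      rw [Set.image_image] at this
      exact this
    refine convexHull_min ?_ hconv
    rintro _ ⟨i, rfl⟩
    fin_cases i
    · exact ⟨(0, 0), by simp, by simp [f]⟩
    · exact ⟨(1, 0), by simp, by simp [f]⟩
    · exact ⟨(0, 1), by simp, by simp [f]⟩
  refine (measure_mono hsub).trans_lt ?_
  refine (hf.hausdorffMeasure_image_le (by norm_num) _).trans_lt ?_
  rw [hausdorffMeasure_prod_real]
  refine ENNReal.mul_lt_top (by simp) ?_
  exact (isCompact_Icc.prod isCompact_Icc).measure_lt_top

lemma exists_fin_three_of_mem_frontier_convexHull {s : Set (EuclideanSpace ℝ (Fin 3))}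
    {x : EuclideanSpace ℝ (Fin 3)} (hx : x ∈ convexHull ℝ s) (hx' : x ∈ frontier (convexHull ℝ s)) :
    ∃ p : Fin 3 → EuclideanSpace ℝ (Fin 3), range p ⊆ s ∧ x ∈ convexHull ℝ (range p) := by
  obtain ⟨ι, _, z, w, hz, hind, hw, hw1, hwx⟩ := eq_pos_convex_span_of_mem_convexHull hx
  have hxz : x ∈ convexHull ℝ (range z) := by
    rw [← hwx]
    exact (convex_convexHull ℝ _).sum_mem (fun i _ => (hw i).le) hw1
      fun i _ => subset_convexHull ℝ _ (mem_range_self i)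
  have hne : Nonempty ι := by
    by_contra h
    rw [not_nonempty_iff] at h
    simp at hw1
  by_cases hc : Fintype.card ι ≤ 3
  · obtain ⟨u⟩ : Nonempty (ι ↪ Fin 3) :=
      Function.Embedding.nonempty_of_card_le (by simpa using hc)
    have hsurj := Function.invFun_surjective u.injective
    refine ⟨z ∘ Function.invFun u, ?_, ?_⟩
    · rw [hsurj.range_comp]; exact hz
    · rw [hsurj.range_comp]; exact hxz
  · exfalso
    have hle : Fintype.card ι ≤ 4 := by
      have h1 := hind.card_le_finrank_succ
      have h2 := Submodule.finrank_le (vectorSpan ℝ (range z))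
      have h3 : Module.finrank ℝ (EuclideanSpace ℝ (Fin 3)) = 3 := by simp
      omega
    have htop : affineSpan ℝ (range z) = ⊤ := by
      rw [hind.affineSpan_eq_top_iff_card_eq_finrank_add_one]
      simp; omega
    let b : AffineBasis ι ℝ (EuclideanSpace ℝ (Fin 3)) := ⟨z, hind, htop⟩
    have hinter : x ∈ interior (convexHull ℝ (range b)) := by
      rw [b.interior_convexHull]
      intro i
      have : x = Finset.univ.affineCombination ℝ b w := by
        rw [Finset.affineCombination_eq_linear_combination _ _ _ hw1]
        exact hwx.symm
      rw [this, b.coord_apply_combination_of_mem (Finset.mem_univ i) hw1]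
      exact hw i
    exact hx'.2 (interior_mono (convexHull_mono hz) hinter)

lemma hausdorffMeasure_two_frontier_convexHull_lt_top {s : Set (EuclideanSpace ℝ (Fin 3))}
    (hs : s.Finite) : μH[2] (frontier (convexHull ℝ s)) < ⊤ := by
  have hcl : IsClosed (convexHull ℝ s) := hs.isClosed_convexHull ℝ
  have hfin : (Set.pi univ fun _ : Fin 3 => s).Finite := Set.Finite.pi fun _ => hs
  have hsub : frontier (convexHull ℝ s) ⊆
      ⋃ p ∈ Set.pi univ fun _ : Fin 3 => s, convexHull ℝ (range p) := by
    intro x hx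
    obtain ⟨p, hp, hxp⟩ :=
      exists_fin_three_of_mem_frontier_convexHull (hcl.frontier_subset hx) hx
    exact mem_biUnion (fun i _ => hp (mem_range_self i)) hxp
  refine (measure_mono hsub).trans_lt ?_
  exact measure_biUnion_lt_top hfin fun p _ => hausdorffMeasure_two_convexHull_triple_lt_top p

/-! ### Double cones over a planar section through the origin -/

/-- A closed convex set in `ℝ³` that is the double cone with apexes `±e₃` over its intersection
with the plane `e₃^⊥`. -/
structure IsDoubleCone (P : Set (EuclideanSpace ℝ (Fin 3))) : Prop where
  isClosed : IsClosed P
  convex : Convex ℝ P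
  zero_mem : 0 ∈ P
  e_mem : e 2 ∈ P
  neg_e_mem : -e 2 ∈ P
  abs_height_le : ∀ x ∈ P, |x 2| ≤ 1
  cone : ∀ x ∈ P, ∃ q ∈ P, q 2 = 0 ∧ x = x 2 • e 2 + (1 - |x 2|) • q

/-- The intersection of `P` with the plane `e₃^⊥`, in planar coordinates. -/
def equator (P : Set (EuclideanSpace ℝ (Fin 3))) : Set (ℝ × ℝ) :=
  {y | !₂[y.1, y.2, 0] ∈ P}

lemma isClosed_equator {P : Set (EuclideanSpace ℝ (Fin 3))} (hP : IsClosed P) :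
    IsClosed (equator P) :=
  hP.preimage (by fun_prop)

lemma convex_equator {P : Set (EuclideanSpace ℝ (Fin 3))} (hP : Convex ℝ P) :
    Convex ℝ (equator P) := by
  intro x hx y hy a b ha hb hab
  have := hP hx hy ha hb hab
  simp only [equator, mem_ofPred_eq]
  convert this using 1
  ext i; fin_cases i <;> simp

lemma volume_eq_volume_coords {P : Set (EuclideanSpace ℝ (Fin 3))} :
    volume P = volume {p : ℝ × (ℝ × ℝ) | !₂[p.2.1, p.2.2, p.1] ∈ P} := by
  let u := (MeasurableEquiv.toLp 2 (Fin 3 → ℝ)).symm.trans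
    ((MeasurableEquiv.piFinSuccAbove (fun _ => ℝ) 2).trans
      (MeasurableEquiv.prodCongr (MeasurableEquiv.refl ℝ) MeasurableEquiv.finTwoArrow))
  have hu : MeasurePreserving u volume volume := by
    refine (EuclideanSpace.volume_preserving_symm_measurableEquiv_toLp (Fin 3)).trans ?_
    refine (volume_preserving_piFinSuccAbove (fun _ => ℝ) 2).trans ?_
    exact (MeasurePreserving.id volume).prod (volume_preserving_finTwoArrow ℝ)
  rw [← hu.measure_preimage_equiv]
  congr 1
  ext x
  have h0 : (u x).2.1 = x 0 := rfl
  have h1 : (u x).2.2 = x 1 := rfl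
  have h2 : (u x).1 = x 2 := rfl
  have : !₂[x 0, x 1, x 2] = x := by ext i; fin_cases i <;> simp
  simp [h0, h1, h2, this]

lemma integral_one_sub_abs_sq : ∫ z in Icc (-1 : ℝ) 1, (1 - |z|) ^ 2 = 2 / 3 := by
  rw [integral_Icc_eq_integral_Ioc, ← intervalIntegral.integral_of_le (by norm_num),
    ← intervalIntegral.integral_add_adjacent_intervals (b := 0)
      (Continuous.intervalIntegrable (by fun_prop) _ _)
      (Continuous.intervalIntegrable (by fun_prop) _ _)]
  have h1 : ∫ z in (-1 : ℝ)..0, (1 - |z|) ^ 2 = ∫ z in (-1 : ℝ)..0, (1 + z) ^ 2 := by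
    refine intervalIntegral.integral_congr fun z hz => ?_
    rw [uIcc_of_le (by norm_num)] at hz
    simp [abs_of_nonpos hz.2]
  have h2 : ∫ z in (0 : ℝ)..1, (1 - |z|) ^ 2 = ∫ z in (0 : ℝ)..1, (1 - z) ^ 2 := by
    refine intervalIntegral.integral_congr fun z hz => ?_
    rw [uIcc_of_le (by norm_num)] at hz
    simp [abs_of_nonneg hz.1]
  rw [h1, h2, intervalIntegral.integral_comp_add_left (fun z => z ^ 2),
    intervalIntegral.integral_comp_sub_left (fun z => z ^ 2)]
  norm_num

lemma IsDoubleCone.volume_le {P : Set (EuclideanSpace ℝ (Fin 3))} (hP : IsDoubleCone P) :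
    volume P ≤ ENNReal.ofReal (2 / 3) * volume (equator P) := by
  have hmeas : MeasurableSet {p : ℝ × (ℝ × ℝ) | !₂[p.2.1, p.2.2, p.1] ∈ P} :=
    (hP.isClosed.preimage (by fun_prop)).measurableSet
  rw [volume_eq_volume_coords, Measure.volume_eq_prod, Measure.prod_apply hmeas]
  have hslice : ∀ z : ℝ,
      volume (Prod.mk z ⁻¹' {p : ℝ × (ℝ × ℝ) | !₂[p.2.1, p.2.2, p.1] ∈ P}) ≤
        (Icc (-1 : ℝ) 1).indicator (fun z => ENNReal.ofReal ((1 - |z|) ^ 2)) z *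
          volume (equator P) := by
    intro z
    by_cases hz : z ∈ Icc (-1 : ℝ) 1
    · have hsub : Prod.mk z ⁻¹' {p : ℝ × (ℝ × ℝ) | !₂[p.2.1, p.2.2, p.1] ∈ P} ⊆
          (1 - |z|) • equator P := by
        intro y hy
        obtain ⟨q, hq, hq2, hyq⟩ := hP.cone _ hy
        have h0 := congrArg (fun x => x 0) hyq
        have h1 := congrArg (fun x => x 1) hyq
        simp [e] at h0 h1
        refine ⟨(q 0, q 1), ?_, ?_⟩
        · have : !₂[q 0, q 1, 0] = q := by ext i; fin_cases i <;> simp [hq2]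
          simpa [equator, this] using hq
        · ext <;> simp [h0, h1]
      refine (measure_mono hsub).trans ?_
      rw [Measure.addHaar_smul, indicator_of_mem hz]
      simp
    · have : Prod.mk z ⁻¹' {p : ℝ × (ℝ × ℝ) | !₂[p.2.1, p.2.2, p.1] ∈ P} = ∅ := by
        ext y
        simp only [mem_preimage, mem_ofPred_eq, mem_empty_iff_false, iff_false]
        intro hy
        have := hP.abs_height_le _ hy
        exact hz (abs_le.1 (by simpa using this))
      simp [this]
  refine (lintegral_mono hslice).trans ?_
  rw [lintegral_mul_const _ (Measurable.indicator (by fun_prop) measurableSet_Icc),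
    lintegral_indicator measurableSet_Icc, ← ofReal_integral_eq_lintegral_ofReal,
    integral_one_sub_abs_sq]
  · exact (Continuous.continuousOn (by fun_prop)).integrableOn_Icc
  · exact ae_of_all _ fun z => sq_nonneg _

/-! ### Lower bound for the surface area -/

/-- The orthogonal projection of `ℝ³` along `(0, 3/5 σ, 4/5 τ)`, for signs `σ` and `τ`. -/
noncomputable def tiltedProj (σ τ : ℝ) (x : EuclideanSpace ℝ (Fin 3)) : ℝ × ℝ :=
  (x 0, 4 / 5 * σ * x 1 - 3 / 5 * τ * x 2)

lemma lipschitzWith_tiltedProj {σ τ : ℝ} (hσ : σ ^ 2 = 1) (hτ : τ ^ 2 = 1) :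
    LipschitzWith 1 (tiltedProj σ τ) := by
  refine LipschitzWith.of_dist_le_mul fun x y => ?_
  rw [NNReal.coe_one, one_mul, EuclideanSpace.dist_eq, Fin.sum_univ_three, Prod.dist_eq]
  simp only [Real.dist_eq, sq_abs, tiltedProj]
  refine max_le ?_ ?_ <;> refine Real.abs_le_sqrt ?_
  · nlinarith [sq_nonneg (x 1 - y 1), sq_nonneg (x 2 - y 2)]
  · have key : (x 1 - y 1) ^ 2 + (x 2 - y 2) ^ 2 -
        (4 / 5 * σ * x 1 - 3 / 5 * τ * x 2 - (4 / 5 * σ * y 1 - 3 / 5 * τ * y 2)) ^ 2 =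
        (3 / 5 * τ * (x 1 - y 1) + 4 / 5 * σ * (x 2 - y 2)) ^ 2 := by
      linear_combination (-(16 / 25) * (x 1 - y 1) ^ 2 - 16 / 25 * (x 2 - y 2) ^ 2) * hσ
        + (-(9 / 25) * (x 1 - y 1) ^ 2 - 9 / 25 * (x 2 - y 2) ^ 2) * hτ
    nlinarith [sq_nonneg (x 0 - y 0),
      sq_nonneg (3 / 5 * τ * (x 1 - y 1) + 4 / 5 * σ * (x 2 - y 2))]

/-- The part of the boundary of `P` lying over the quadrant `0 < σ x₁`, `0 < τ x₂`. -/
def frontierQuadrant (P : Set (EuclideanSpace ℝ (Fin 3))) (σ τ : ℝ) :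
    Set (EuclideanSpace ℝ (Fin 3)) :=
  {x ∈ frontier P | 0 < σ * x 1 ∧ 0 < τ * x 2}

lemma exists_pos_add_smul_mem_frontier {E : Type*} [NormedAddCommGroup E] [NormedSpace ℝ E]
    {P : Set E} (hP : IsClosed P) {p n : E} (hp : p ∈ interior P) {T : ℝ} (hT : 0 ≤ T)
    (hpT : p + T • n ∉ P) : ∃ t : ℝ, 0 < t ∧ p + t • n ∈ frontier P := by
  by_contra! h
  let γ : ℝ → E := fun t => p + t • n
  have hγ : Continuous γ := by fun_prop
  have hγ0 : γ 0 = p := by simp [γ]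
  have hcover : Icc 0 T ⊆ γ ⁻¹' interior P ∪ γ ⁻¹' Pᶜ := by
    intro t ht
    rcases ht.1.eq_or_lt with rfl | ht0
    · left; rw [mem_preimage, hγ0]; exact hp
    · by_cases htP : γ t ∈ P
      · left
        by_contra hti
        exact h t ht0 ⟨subset_closure htP, hti⟩
      · exact Or.inr htP
  obtain ⟨t, -, ht1, ht2⟩ := isPreconnected_Icc (a := (0 : ℝ)) (b := T) _ _
    (isOpen_interior.preimage hγ) (hP.isOpen_compl.preimage hγ) hcover
    ⟨0, ⟨le_rfl, hT⟩, by rw [mem_preimage, hγ0]; exact hp⟩ ⟨T, ⟨hT, le_rfl⟩, hpT⟩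
  exact ht2 (interior_subset ht1)

lemma IsDoubleCone.tiltedProj_mem_image_frontierQuadrant {P : Set (EuclideanSpace ℝ (Fin 3))}
    (hP : IsDoubleCone P) {σ τ : ℝ} (hσ : σ ^ 2 = 1) (hτ : τ ^ 2 = 1)
    {p : EuclideanSpace ℝ (Fin 3)} (hp : p ∈ interior P) (hp1 : 0 ≤ σ * p 1) (hp2 : 0 ≤ τ * p 2) :
    tiltedProj σ τ p ∈ tiltedProj σ τ '' frontierQuadrant P σ τ := by
  let n : EuclideanSpace ℝ (Fin 3) := !₂[0, 3 / 5 * σ, 4 / 5 * τ]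
  have hn1 : ∀ t : ℝ, σ * (p + t • n) 1 = σ * p 1 + 3 / 5 * t := by
    intro t
    simp only [n, PiLp.add_apply, PiLp.smul_apply, smul_eq_mul,
      Matrix.cons_val_one, Matrix.cons_val_zero]
    linear_combination 3 / 5 * t * hσ
  have hn2 : ∀ t : ℝ, τ * (p + t • n) 2 = τ * p 2 + 4 / 5 * t := by
    intro t
    simp only [n, PiLp.add_apply, PiLp.smul_apply, smul_eq_mul,
      Matrix.cons_val]
    linear_combination 4 / 5 * t * hτ
  have hout : p + (2 : ℝ) • n ∉ P := by
    intro h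
    have h1 := hP.abs_height_le _ h
    have h2 := hn2 2
    have h3 : (p + (2 : ℝ) • n) 2 ^ 2 ≤ 1 := by
      rw [← sq_abs]; nlinarith [abs_nonneg ((p + (2 : ℝ) • n) 2)]
    have h4 : (τ * (p + (2 : ℝ) • n) 2) ^ 2 ≤ 1 := by rw [mul_pow, hτ, one_mul]; exact h3
    rw [h2] at h4
    nlinarith
  obtain ⟨t, ht, htP⟩ := exists_pos_add_smul_mem_frontier hP.isClosed hp zero_le_two hout
  refine ⟨p + t • n, ⟨htP, ?_, ?_⟩, ?_⟩
  · rw [hn1]; positivity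
  · rw [hn2]; positivity
  · ext
    · simp [tiltedProj, n]
    · simp only [tiltedProj, n, PiLp.add_apply, PiLp.smul_apply, smul_eq_mul,
        Matrix.cons_val, Matrix.cons_val_one, Matrix.cons_val_zero]
      linear_combination 12 / 25 * t * hσ - 12 / 25 * t * hτ

lemma volume_preimage_snd_mul {k : ℝ} (hk : k ≠ 0) {S : Set (ℝ × ℝ)} (hS : MeasurableSet S) :
    volume {p : ℝ × ℝ | (p.1, k * p.2) ∈ S} = ENNReal.ofReal |k⁻¹| * volume S := by
  have hS' : MeasurableSet {p : ℝ × ℝ | (p.1, k * p.2) ∈ S} :=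
    hS.preimage (by fun_prop : Measurable fun p : ℝ × ℝ => (p.1, k * p.2))
  rw [Measure.volume_eq_prod, Measure.prod_apply hS', Measure.prod_apply hS,
    ← lintegral_const_mul _ (measurable_measure_prodMk_left hS)]
  congr 1
  ext a
  exact Real.volume_preimage_mul_left hk (Prod.mk a ⁻¹' S)

lemma volume_triangle_below_axis {r s : ℝ} (hr : 0 < r) (hs : 0 ≤ s) :
    volume (regionBetween (fun a : ℝ => -(s * (1 - a / r))) (fun _ => 0) (Ioo 0 r)) =
      ENNReal.ofReal (s * r / 2) := by
  rw [Measure.volume_eq_prod, volume_regionBetween_eq_integral]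
  · congr 1
    have : ∀ a : ℝ,
        ((fun _ : ℝ => (0 : ℝ)) - fun a : ℝ => -(s * (1 - a / r))) a = s - s / r * a := by
      intro a; simp; ring
    simp only [this]
    rw [← integral_Ioc_eq_integral_Ioo, ← intervalIntegral.integral_of_le hr.le,
      intervalIntegral.integral_sub (by simp) (Continuous.intervalIntegrable (by fun_prop) _ _),
      intervalIntegral.integral_const_mul, integral_id]
    simp
    field_simp
    ring
  · exact (Continuous.continuousOn (by fun_prop)).integrableOn_Icc.mono_set Ioo_subset_Icc_self
  · exact (Continuous.continuousOn (by fun_prop)).integrableOn_Icc.mono_set Ioo_subset_Icc_self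
  · exact measurableSet_Ioo
  · intro a ha
    have : a / r ≤ 1 := (div_le_one hr).2 ha.2.le
    nlinarith [mul_nonneg hs (sub_nonneg.2 this)]

lemma IsDoubleCone.mem_interior_of_mem_interior_equator {P : Set (EuclideanSpace ℝ (Fin 3))}
    (hP : IsDoubleCone P) {r : ℝ} (hw : !₂[r, 0, 0] ∈ interior P) {y : ℝ × ℝ}
    (hy : y ∈ interior (equator P)) : !₂[y.1, y.2, 0] ∈ interior P := by
  have hcont : Continuous fun ε : ℝ => y + ε • (y - (r, 0)) := by fun_prop
  have hev : ∀ᶠ ε : ℝ in 𝓝 0, y + ε • (y - (r, 0)) ∈ equator P := by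
    refine hcont.continuousAt.eventually_mem ?_
    simpa using mem_interior_iff_mem_nhds.1 hy
  obtain ⟨ε, hε, hε0⟩ :=
    ((hev.filter_mono nhdsWithin_le_nhds).and (self_mem_nhdsWithin (s := Ioi (0 : ℝ)))).exists
  replace hε0 : 0 < ε := hε0
  have := hP.convex.combo_interior_self_mem_interior hw hε (a := ε / (1 + ε)) (b := 1 / (1 + ε))
    (by positivity) (by positivity) (by field_simp; ring)
  convert this using 1
  ext i
  fin_cases i
  · simp; field_simp; ring
  · simp; field_simp
  · simp

lemma IsDoubleCone.le_hausdorffMeasure_frontierQuadrant {P : Set (EuclideanSpace ℝ (Fin 3))}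
    (hP : IsDoubleCone P) {r : ℝ} (hr : 0 < r) (hw : !₂[r, 0, 0] ∈ interior P)
    {σ τ : ℝ} (hσ : σ ^ 2 = 1) (hτ : τ ^ 2 = 1) :
    ENNReal.ofReal (4 / 5) * volume (interior (equator P) ∩ {y | 0 < σ * y.2}) +
      ENNReal.ofReal (3 / 5 * r / 2) ≤ μH[2] (frontierQuadrant P σ τ) := by
  have hσ0 : σ ≠ 0 := by rintro rfl; norm_num at hσ
  have hσa : |σ| = 1 := by
    rcases mul_self_eq_one_iff.1 ((sq σ).symm.trans hσ) with rfl | rfl <;> simp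
  set S := interior (equator P) ∩ {y | 0 < σ * y.2}
  have hS : MeasurableSet S :=
    isOpen_interior.measurableSet.inter (isOpen_lt (by fun_prop) (by fun_prop)).measurableSet
  set R := {p : ℝ × ℝ | (p.1, 5 / 4 * σ * p.2) ∈ S}
  set T := regionBetween (fun a : ℝ => -(3 / 5 * (1 - a / r))) (fun _ => 0) (Ioo 0 r)
  have hR : volume R = ENNReal.ofReal (4 / 5) * volume S := by
    rw [volume_preimage_snd_mul (by positivity) hS, abs_inv, abs_mul, hσa]
    norm_num [abs_of_pos]
  have hT : volume T = ENNReal.ofReal (3 / 5 * r / 2) :=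
    volume_triangle_below_axis hr (by norm_num)
  have hTmeas : MeasurableSet T :=
    measurableSet_regionBetween (by fun_prop) (by fun_prop) measurableSet_Ioo
  have hdisj : Disjoint R T := by
    rw [Set.disjoint_left]
    rintro ⟨a, b⟩ ⟨-, hb⟩ ⟨-, hb'⟩
    simp only [mem_ofPred_eq, mem_Ioo] at hb hb'
    nlinarith [hb'.2]
  have hRsub : R ⊆ tiltedProj σ τ '' frontierQuadrant P σ τ := by
    rintro ⟨a, b⟩ ⟨hab, hb⟩
    have hp := hP.mem_interior_of_mem_interior_equator hw hab
    have := hP.tiltedProj_mem_image_frontierQuadrant hσ hτ hp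
      (by simpa using le_of_lt hb) (by simp)
    convert this using 1
    ext
    · simp [tiltedProj]
    · simp [tiltedProj]
      linear_combination -b * hσ
  have hTsub : T ⊆ tiltedProj σ τ '' frontierQuadrant P σ τ := by
    rintro ⟨a, b⟩ ⟨ha, hb⟩
    simp only [mem_Ioo] at ha hb
    have har : 0 < 1 - a / r := sub_pos.2 ((div_lt_one hr).2 ha.2)
    set c := 1 - a / r with hc
    have hτe : ∀ k : ℝ, 0 ≤ k → k ≤ 1 → (k * τ) • e 2 ∈ P := by
      intro k hk hk1
      rcases mul_self_eq_one_iff.1 ((sq τ).symm.trans hτ) with rfl | rfl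
      · simpa using hP.convex.smul_mem_of_zero_mem hP.zero_mem hP.e_mem ⟨hk, hk1⟩
      · simpa using hP.convex.smul_mem_of_zero_mem hP.zero_mem hP.neg_e_mem ⟨hk, hk1⟩
    have hk : (-(5 / 3) * b / c * τ) • e 2 ∈ P := by
      refine hτe _ (div_nonneg (by linarith [hb.2]) har.le) ?_
      rw [div_le_one har]; linarith [hb.1]
    have hp := hP.convex.combo_interior_self_mem_interior hw hk (a := a / r) (b := c)
      (div_pos ha.1 hr) har.le (by rw [hc]; ring)
    have := hP.tiltedProj_mem_image_frontierQuadrant hσ hτ hp (by simp [e]) (by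
      have : τ * ((a / r) • !₂[r, 0, 0] + c • (-(5 / 3) * b / c * τ) • e 2) 2 = -(5 / 3) * b := by
        simp [e]
        field_simp
        linear_combination -b * hτ
      rw [this]
      linarith [hb.2])
    convert this using 1
    ext
    · simp [tiltedProj, e]
      field_simp
    · simp [tiltedProj, e]
      field_simp
      linear_combination -b * hτ
  calc _ = volume R + volume T := by rw [hR, hT]
    _ = volume (R ∪ T) := (measure_union hdisj hTmeas).symm
    _ ≤ volume (tiltedProj σ τ '' frontierQuadrant P σ τ) :=
      measure_mono (union_subset hRsub hTsub)
    _ ≤ μH[2] (frontierQuadrant P σ τ) := by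
      rw [← hausdorffMeasure_prod_real]
      simpa using (lipschitzWith_tiltedProj hσ hτ).hausdorffMeasure_image_le zero_le_two
        (frontierQuadrant P σ τ)

lemma measurableSet_frontierQuadrant (P : Set (EuclideanSpace ℝ (Fin 3))) (σ τ : ℝ) :
    MeasurableSet (frontierQuadrant P σ τ) :=
  isClosed_frontier.measurableSet.inter
    ((isOpen_lt continuous_const
        (by fun_prop : Continuous fun x : EuclideanSpace ℝ (Fin 3) => σ * x 1)).inter
      (isOpen_lt continuous_const
        (by fun_prop : Continuous fun x : EuclideanSpace ℝ (Fin 3) => τ * x 2))).measurableSet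

lemma volume_equator_le {P : Set (EuclideanSpace ℝ (Fin 3))} (hP : Convex ℝ P) :
    volume (equator P) ≤ volume (interior (equator P) ∩ {y | 0 < 1 * y.2}) +
      volume (interior (equator P) ∩ {y | 0 < -1 * y.2}) := by
  have hline : volume {y : ℝ × ℝ | y.2 = 0} = 0 := by
    have : {y : ℝ × ℝ | y.2 = 0} = univ ×ˢ {0} := by ext; simp
    rw [this, Measure.volume_eq_prod, Measure.prod_prod]
    simp
  have hsub : equator P ⊆ (interior (equator P) ∩ {y | 0 < 1 * y.2} ∪
      interior (equator P) ∩ {y | 0 < -1 * y.2}) ∪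
        (frontier (equator P) ∪ {y : ℝ × ℝ | y.2 = 0}) := by
    intro y hy
    by_cases hi : y ∈ interior (equator P)
    · rcases lt_trichotomy y.2 0 with h | h | h
      · exact Or.inl (Or.inr ⟨hi, by simpa using h⟩)
      · exact Or.inr (Or.inr h)
      · exact Or.inl (Or.inl ⟨hi, by simpa using h⟩)
    · exact Or.inr (Or.inl ⟨subset_closure hy, hi⟩)
  calc volume (equator P) ≤ _ := measure_mono hsub
    _ ≤ _ := measure_union_le _ _
    _ ≤ _ := add_le_add (measure_union_le _ _) (measure_union_le _ _)
    _ = _ := by rw [(convex_equator hP).addHaar_frontier volume, hline, add_zero, add_zero]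

lemma IsDoubleCone.le_hausdorffMeasure_frontier {P : Set (EuclideanSpace ℝ (Fin 3))}
    (hP : IsDoubleCone P) {r : ℝ} (hr : 0 < r) (hw : !₂[r, 0, 0] ∈ interior P) :
    2 * (ENNReal.ofReal (4 / 5) * volume (equator P)) + 4 * ENNReal.ofReal (3 / 5 * r / 2) ≤
      μH[2] (frontier P) := by
  have hdisj₂ : ∀ σ : ℝ, Disjoint (frontierQuadrant P σ 1) (frontierQuadrant P σ (-1)) := by
    intro σ
    rw [Set.disjoint_left]
    rintro x ⟨-, -, h⟩ ⟨-, -, h'⟩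
    linarith
  have hdisj₁ : Disjoint (frontierQuadrant P 1 1 ∪ frontierQuadrant P 1 (-1))
      (frontierQuadrant P (-1) 1 ∪ frontierQuadrant P (-1) (-1)) := by
    rw [Set.disjoint_left]
    rintro x (⟨-, h, -⟩ | ⟨-, h, -⟩) (⟨-, h', -⟩ | ⟨-, h', -⟩) <;> linarith
  have hsub : (frontierQuadrant P 1 1 ∪ frontierQuadrant P 1 (-1)) ∪
      (frontierQuadrant P (-1) 1 ∪ frontierQuadrant P (-1) (-1)) ⊆ frontier P := by
    rintro x ((h | h) | (h | h)) <;> exact h.1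
  have hm := measurableSet_frontierQuadrant P
  have h1 : (1 : ℝ) ^ 2 = 1 := by norm_num
  have h2 : (-1 : ℝ) ^ 2 = 1 := by norm_num
  refine le_trans ?_ (measure_mono hsub)
  rw [measure_union hdisj₁ ((hm _ _).union (hm _ _)), measure_union (hdisj₂ 1) (hm _ _),
    measure_union (hdisj₂ (-1)) (hm _ _)]
  refine le_trans ?_ (add_le_add
    (add_le_add (hP.le_hausdorffMeasure_frontierQuadrant hr hw h1 h1)
      (hP.le_hausdorffMeasure_frontierQuadrant hr hw h1 h2))
    (add_le_add (hP.le_hausdorffMeasure_frontierQuadrant hr hw h2 h1)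
      (hP.le_hausdorffMeasure_frontierQuadrant hr hw h2 h2)))
  have hA := mul_le_mul_right (volume_equator_le hP.convex) (ENNReal.ofReal (4 / 5))
  have hA' := mul_le_mul_right hA 2
  refine (add_le_add_left hA' _).trans (le_of_eq ?_)
  ring

lemma IsDoubleCone.lt_sArea_pow_div_vol_pow {P : Set (EuclideanSpace ℝ (Fin 3))}
    (hP : IsDoubleCone P) (hfin : μH[2] (frontier P) < ⊤) {r : ℝ} (hr : 16 ≤ r)
    (hw : !₂[r, 0, 0] ∈ interior P) : 344 < sArea P ^ 3 / vol P ^ 2 := by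
  have hr0 : 0 < r := by linarith
  have hS := hP.le_hausdorffMeasure_frontier hr0 hw
  have hA : volume (equator P) ≠ ⊤ := by
    intro h
    rw [h] at hS
    have : (⊤ : ENNReal) ≤ μH[2] (frontier P) := by
      refine le_trans ?_ hS
      rw [ENNReal.mul_top (by simp), ENNReal.mul_top (by simp), top_add]
    exact absurd hfin (not_lt.2 this)
  have hV := hP.volume_le
  have hVtop : volume P ≠ ⊤ :=
    (hV.trans_lt (ENNReal.mul_lt_top ENNReal.ofReal_lt_top hA.lt_top)).ne
  have hVpos : 0 < vol P := by
    refine ENNReal.toReal_pos (ne_of_gt ?_) hVtop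
    exact (isOpen_interior.measure_pos volume ⟨_, hw⟩).trans_le (measure_mono interior_subset)
  have hVle : vol P ≤ 2 / 3 * (volume (equator P)).toReal := by
    have := ENNReal.toReal_mono (ENNReal.mul_ne_top ENNReal.ofReal_ne_top hA) hV
    rwa [ENNReal.toReal_mul, ENNReal.toReal_ofReal (by norm_num)] at this
  have hSge : 8 / 5 * (volume (equator P)).toReal + 6 / 5 * r ≤ sArea P := by
    have := ENNReal.toReal_mono hfin.ne hS
    rw [ENNReal.toReal_add (by finiteness) (by finiteness), ENNReal.toReal_mul,
      ENNReal.toReal_mul, ENNReal.toReal_mul, ENNReal.toReal_ofReal (by norm_num),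
      ENNReal.toReal_ofReal (by positivity)] at this
    simp only [ENNReal.toReal_ofNat] at this
    unfold sArea
    linarith
  set A := (volume (equator P)).toReal
  have hA0 : 0 < A := by linarith
  have hS' : 8 / 5 * A + 96 / 5 ≤ sArea P := by linarith
  have hcube : (8 / 5 * A + 96 / 5) ^ 3 ≤ sArea P ^ 3 := by gcongr
  have hsq : vol P ^ 2 ≤ (2 / 3 * A) ^ 2 := by gcongr
  rw [lt_div_iff₀ (by positivity)]
  nlinarith [mul_nonneg (sq_nonneg (8 / 5 * A - 2 * (96 / 5)))
    (by positivity : 0 ≤ 8 / 5 * A + 96 / 5 / 4), sq_pos_of_pos hA0]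

/-! ### Rotating about the vertical axis -/

lemma exists_rotation {w : EuclideanSpace ℝ (Fin 3)} (hw : w 2 = 0) (hw0 : w ≠ 0) :
    ∃ R : EuclideanSpace ℝ (Fin 3) ≃ₗᵢ[ℝ] EuclideanSpace ℝ (Fin 3),
      R w = !₂[‖w‖, 0, 0] ∧ R (e 2) = e 2 ∧ ∀ x, R x 2 = x 2 := by
  have hn : 0 < ‖w‖ := norm_pos_iff.2 hw0
  have hsq : w 0 ^ 2 + w 1 ^ 2 = ‖w‖ ^ 2 := by
    rw [EuclideanSpace.real_norm_sq_eq, Fin.sum_univ_three, hw]; ring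
  let α := w 0 / ‖w‖
  let β := w 1 / ‖w‖
  have hαβ : α ^ 2 + β ^ 2 = 1 := by
    simp only [α, β]; field_simp; exact hsq
  let f : EuclideanSpace ℝ (Fin 3) →ₗᵢ[ℝ] EuclideanSpace ℝ (Fin 3) :=
    { toFun := fun x => !₂[α * x 0 + β * x 1, -β * x 0 + α * x 1, x 2]
      map_add' := fun x y => by ext i; fin_cases i <;> simp <;> ring
      map_smul' := fun c x => by ext i; fin_cases i <;> simp <;> ring
      norm_map' := fun x => by
        rw [← sq_eq_sq₀ (norm_nonneg _) (norm_nonneg _), EuclideanSpace.real_norm_sq_eq,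
          EuclideanSpace.real_norm_sq_eq, Fin.sum_univ_three, Fin.sum_univ_three]
        simp
        linear_combination (x 0 ^ 2 + x 1 ^ 2) * hαβ }
  have hf : ∀ x, f x = !₂[α * x 0 + β * x 1, -β * x 0 + α * x 1, x 2] := fun x => rfl
  refine ⟨f.toLinearIsometryEquiv rfl, ?_, ?_, fun x => ?_⟩
  · rw [LinearIsometry.coe_toLinearIsometryEquiv, hf, hw]
    ext i
    fin_cases i
    · simp [α, β]; field_simp; exact hsq
    · simp [α, β]; field_simp; ring
    · simp
  · rw [LinearIsometry.coe_toLinearIsometryEquiv, hf]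
    ext i; fin_cases i <;> simp [e]
  · rw [LinearIsometry.coe_toLinearIsometryEquiv, hf]
    simp

lemma IsDoubleCone.image {P : Set (EuclideanSpace ℝ (Fin 3))} (hP : IsDoubleCone P)
    (R : EuclideanSpace ℝ (Fin 3) ≃ₗᵢ[ℝ] EuclideanSpace ℝ (Fin 3)) (hRe : R (e 2) = e 2)
    (hR2 : ∀ x, R x 2 = x 2) : IsDoubleCone (R '' P) where
  isClosed := R.toHomeomorph.isClosedMap _ hP.isClosed
  convex := hP.convex.linear_image R.toLinearEquiv.toLinearMap
  zero_mem := ⟨0, hP.zero_mem, map_zero R⟩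
  e_mem := ⟨e 2, hP.e_mem, hRe⟩
  neg_e_mem := ⟨-e 2, hP.neg_e_mem, by rw [map_neg, hRe]⟩
  abs_height_le := by
    rintro _ ⟨x, hx, rfl⟩
    rw [hR2]; exact hP.abs_height_le x hx
  cone := by
    rintro _ ⟨x, hx, rfl⟩
    obtain ⟨q, hq, hq2, hxq⟩ := hP.cone x hx
    refine ⟨R q, ⟨q, hq, rfl⟩, by rw [hR2, hq2], ?_⟩
    rw [hR2]
    conv_lhs => rw [hxq, map_add, map_smul, map_smul, hRe]

lemma hausdorffMeasure_frontier_image (R : EuclideanSpace ℝ (Fin 3) ≃ₗᵢ[ℝ] EuclideanSpace ℝ (Fin 3))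
    (P : Set (EuclideanSpace ℝ (Fin 3))) :
    μH[2] (frontier (R '' P)) = μH[2] (frontier P) := by
  have : frontier (R '' P) = R.toIsometryEquiv '' frontier P :=
    (R.toHomeomorph.image_frontier P).symm
  rw [this, IsometryEquiv.hausdorffMeasure_image]

lemma vol_image (R : EuclideanSpace ℝ (Fin 3) ≃ₗᵢ[ℝ] EuclideanSpace ℝ (Fin 3))
    (P : Set (EuclideanSpace ℝ (Fin 3))) : vol (R '' P) = vol P := by
  have h := R.measurePreserving.measure_preimage_emb R.toHomeomorph.measurableEmbedding (R '' P)
  rw [R.injective.preimage_image] at h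
  rw [vol, vol, h]

/-! ### The convex hull -/

lemma isDoubleCone_convexHull {v : Fin 4 → EuclideanSpace ℝ (Fin 3)} (hv : ∀ i, v i 2 = 0) :
    IsDoubleCone (convexHull ℝ
      ({e 2, -e 2, 0} ∪ range v : Set (EuclideanSpace ℝ (Fin 3)))) := by
  have hfin : ({e 2, -e 2, 0} ∪ range v : Set (EuclideanSpace ℝ (Fin 3))).Finite :=
    (by simp : ({e 2, -e 2, 0} : Set (EuclideanSpace ℝ (Fin 3))).Finite).union (finite_range v)
  have hmem : ∀ x ∈ ({e 2, -e 2, 0} ∪ range v : Set (EuclideanSpace ℝ (Fin 3))), x ∈ convexHull ℝ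
      ({e 2, -e 2, 0} ∪ range v : Set (EuclideanSpace ℝ (Fin 3))) :=
    fun x hx => subset_convexHull ℝ _ hx
  set H := convexHull ℝ ({0} ∪ range v : Set (EuclideanSpace ℝ (Fin 3))) with hH
  have hHP : H ⊆ convexHull ℝ ({e 2, -e 2, 0} ∪ range v : Set (EuclideanSpace ℝ (Fin 3))) :=
    convexHull_mono (union_subset_union_left _ (by simp))
  have hH0 : (0 : EuclideanSpace ℝ (Fin 3)) ∈ H := subset_convexHull ℝ _ (by simp)
  have hH2 : ∀ h ∈ H, h 2 = 0 := by
    have hplane : Convex ℝ {x : EuclideanSpace ℝ (Fin 3) | x 2 = 0} :=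
      convex_hyperplane (f := fun x : EuclideanSpace ℝ (Fin 3) => x 2) ⟨by simp, by simp⟩ 0
    refine fun h hh => convexHull_min ?_ hplane hh
    rintro x (rfl | ⟨i, rfl⟩)
    · simp
    · exact hv i
  have hdecomp : ∀ x ∈ convexHull ℝ
      ({e 2, -e 2, 0} ∪ range v : Set (EuclideanSpace ℝ (Fin 3))),
      |x 2| ≤ 1 ∧ ∃ q ∈ H, x = x 2 • e 2 + (1 - |x 2|) • q := by
    intro x hx
    rw [insert_union, insert_union, convexHull_insert (by simp),
      convexHull_insert (by simp), ← hH] at hx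
    simp only [mem_convexJoin, mem_singleton_iff, exists_eq_left] at hx
    obtain ⟨y, ⟨h, hh, c, d, hc, hd, hcd, rfl⟩, a, b, ha, hb, hab, rfl⟩ := hx
    have hbc := mul_nonneg hb hc
    have hbd := mul_nonneg hb hd
    have hsum : b * c + b * d = b := by rw [← mul_add, hcd, mul_one]
    have hx2 : (a • e 2 + b • (c • -e 2 + d • h)) 2 = a - b * c := by
      simp [e, hH2 h hh]; ring
    rw [hx2]
    have habs : |a - b * c| ≤ 1 - b * d := by
      rw [abs_le]; constructor <;> linarith
    set t := |a - b * c|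
    refine ⟨by linarith, (b * d / (1 - t)) • h, ?_, ?_⟩
    · refine (convex_convexHull ℝ _).smul_mem_of_zero_mem hH0 hh
        ⟨div_nonneg hbd (by linarith), div_le_one_of_le₀ (by linarith) (by linarith)⟩
    · have hcancel : (1 - t) * (b * d / (1 - t)) = b * d := by
        rcases eq_or_ne (1 - t) 0 with h0 | h0
        · rw [h0]; linarith
        · field_simp
      rw [smul_smul, hcancel]
      module
  exact
    { isClosed := hfin.isClosed_convexHull ℝ
      convex := convex_convexHull ℝ _
      zero_mem := hmem _ (by simp)
      e_mem := hmem _ (by simp)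
      neg_e_mem := hmem _ (by simp)
      abs_height_le := fun x hx => (hdecomp x hx).1
      cone := fun x hx => by
        obtain ⟨-, q, hq, hxq⟩ := hdecomp x hx
        exact ⟨q, hHP hq, hH2 q hq, hxq⟩ }

lemma interior_convexHull_nonempty {v : Fin 4 → EuclideanSpace ℝ (Fin 3)} (hv : ∀ i, v i 2 = 0)
    (hQ : ¬ Collinear ℝ ({0} ∪ range v : Set (EuclideanSpace ℝ (Fin 3)))) :
    (interior (convexHull ℝ
      ({e 2, -e 2, 0} ∪ range v : Set (EuclideanSpace ℝ (Fin 3))))).Nonempty := by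
  rw [interior_convexHull_nonempty_iff_affineSpan_eq_top]
  set s := ({e 2, -e 2, 0} ∪ range v : Set (EuclideanSpace ℝ (Fin 3)))
  have h0 : (0 : EuclideanSpace ℝ (Fin 3)) ∈ affineSpan ℝ s :=
    subset_affineSpan ℝ _ (by simp [s])
  rw [← AffineSubspace.direction_eq_top_iff_of_nonempty ⟨0, h0⟩]
  by_contra hne
  rw [← Submodule.orthogonal_eq_bot_iff, Submodule.eq_bot_iff] at hne
  push Not at hne
  obtain ⟨u, hu, hu0⟩ := hne
  have hinner : ∀ x ∈ s, inner ℝ x u = (0 : ℝ) := by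
    intro x hx
    refine hu x ?_
    simpa using AffineSubspace.vsub_mem_direction (subset_affineSpan ℝ _ hx) h0
  have hu2 : u 2 = 0 := by
    have := hinner (e 2) (by simp [s])
    simpa [PiLp.inner_apply, Fin.sum_univ_three, e] using this
  have hpos : 0 < u 0 ^ 2 + u 1 ^ 2 := by
    have h := EuclideanSpace.real_norm_sq_eq u
    rw [Fin.sum_univ_three, hu2] at h
    have : 0 < ‖u‖ := norm_pos_iff.2 hu0
    nlinarith
  apply hQ
  rw [collinear_iff_of_mem (p₀ := 0) (by simp)]
  refine ⟨!₂[-u 1, u 0, 0], ?_⟩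
  rintro p (rfl | ⟨i, rfl⟩)
  · exact ⟨0, by simp⟩
  · have h := hinner (v i) (by simp [s])
    simp [PiLp.inner_apply, Fin.sum_univ_three, hu2] at h
    refine ⟨(-u 1 * v i 0 + u 0 * v i 1) / (u 0 ^ 2 + u 1 ^ 2), ?_⟩
    ext j
    fin_cases j
    · simp
      field_simp
      linear_combination u 0 * h
    · simp
      field_simp
      linear_combination u 1 * h
    · simp [hv i]

/-- A double cone with nonempty interior has interior points in `e₃^⊥` close to each of its
points in that plane. -/
lemma IsDoubleCone.exists_mem_interior {P : Set (EuclideanSpace ℝ (Fin 3))}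
    (hP : IsDoubleCone P) (hinter : (interior P).Nonempty) {p : EuclideanSpace ℝ (Fin 3)}
    (hp : p ∈ P) (hp2 : p 2 = 0) {c : ℝ} (hc : c < ‖p‖) :
    ∃ w ∈ interior P, w 2 = 0 ∧ c < ‖w‖ := by
  obtain ⟨g, hg⟩ := hinter
  obtain ⟨g', hg', hg2⟩ : ∃ g' ∈ interior P, g' 2 = 0 := by
    have hk : -(SignType.sign (g 2) : ℝ) • e 2 ∈ P := by
      rcases lt_trichotomy (g 2) 0 with h | h | h
      · simpa [h] using hP.e_mem
      · simpa [h] using hP.zero_mem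
      · simpa [h] using hP.neg_e_mem
    have h1 : 0 < 1 + |g 2| := by positivity
    refine ⟨_, hP.convex.combo_interior_self_mem_interior hg hk (a := 1 / (1 + |g 2|))
      (b := |g 2| / (1 + |g 2|)) (by positivity) (by positivity) (by field_simp), ?_⟩
    simp [e]
    field_simp
    rw [abs_mul_sign]
    ring
  have hcont : Continuous fun ε : ℝ => ‖ε • g' + (1 - ε) • p‖ := by fun_prop
  have hev : ∀ᶠ ε : ℝ in 𝓝 0, c < ‖ε • g' + (1 - ε) • p‖ :=
    hcont.continuousAt.eventually (lt_mem_nhds (by simpa using hc))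
  obtain ⟨ε, hε, hε0, hε1⟩ := ((hev.filter_mono nhdsWithin_le_nhds).and
    (Ioo_mem_nhdsGT (zero_lt_one' ℝ))).exists
  refine ⟨_, hP.convex.combo_interior_self_mem_interior hg' hp hε0 (sub_nonneg.2 hε1.le)
    (by ring), ?_, hε⟩
  simp [hg2, hp2]

theorem stmt_13 (v : Fin 4 → EuclideanSpace ℝ (Fin 3))
    (hvplane : ∀ i, v i 2 = 0)
    (hQdim : ¬ Collinear ℝ ({0} ∪ Set.range v : Set (EuclideanSpace ℝ (Fin 3))))
    (P : Set (EuclideanSpace ℝ (Fin 3)))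
    (hP : P = convexHull ℝ
      ({e 2, -e 2, 0} ∪ Set.range v : Set (EuclideanSpace ℝ (Fin 3))))
    (hfar : ∃ i, 17 ≤ ‖v i‖) :
    344 < sArea P ^ 3 / vol P ^ 2 := by
  obtain ⟨i, hi⟩ := hfar
  have hcone : IsDoubleCone P := hP ▸ isDoubleCone_convexHull hvplane
  have hinter : (interior P).Nonempty := hP ▸ interior_convexHull_nonempty hvplane hQdim
  have hfin : μH[2] (frontier P) < ⊤ := by
    rw [hP]
    refine hausdorffMeasure_two_frontier_convexHull_lt_top ?_
    exact (by simp : ({e 2, -e 2, 0} : Set (EuclideanSpace ℝ (Fin 3))).Finite).union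
      (finite_range v)
  have hvP : v i ∈ P := by rw [hP]; exact subset_convexHull ℝ _ (by simp)
  obtain ⟨w, hw, hw2, hw16⟩ := hcone.exists_mem_interior hinter hvP (hvplane i)
    (by linarith : (16 : ℝ) < ‖v i‖)
  obtain ⟨R, hRw, hRe, hR2⟩ := exists_rotation hw2 (norm_pos_iff.1 (by linarith))
  have hRint : !₂[‖w‖, 0, 0] ∈ interior (R '' P) := by
    rw [← hRw]
    have : interior (R '' P) = R '' interior P := (R.toHomeomorph.image_interior P).symm
    rw [this]
    exact mem_image_of_mem R hw
  have hmain := (hcone.image R hRe hR2).lt_sArea_pow_div_vol_pow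
    (by rwa [hausdorffMeasure_frontier_image]) hw16.le hRint
  rwa [vol_image, sArea, hausdorffMeasure_frontier_image] at hmain
end

section
/- Let x₁, x₂, x₃, y₁, y₂ be real numbers satisfying 0 ≤ x₁ ≤ x₂ ≤ x₃ ≤ 6.5, 0 ≤ y₁ ≤ 6.5, 0 ≤ y₂ ≤ 6.5, x₂y₁ − x₁y₂ ≥ 0, (x₃ − x₁)y₂ − (x₃ − x₂)y₁ ≥ 0, and x₂y₁ − x₁y₂ + x₃y₂ ≥ 0.411. Define S = 2√(x₁² + y₁²) + 2√((x₁ − x₂)² + (y₁ − y₂)² + (x₂y₁ − x₁y₂)²) + 2√(y₂² + (x₃ − x₂)² + x₃²y₂²) and V = (2/3)·(x₂y₁ − x₁y₂ + x₃y₂). Then S³ − 188·V² > 3.44. -/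
theorem add_mul_le_sqrt_of_sq_add_sq_le_one {a b : ℝ} (h : a ^ 2 + b ^ 2 ≤ 1) (x y : ℝ) :
    a * x + b * y ≤ √(x ^ 2 + y ^ 2) := by
  apply Real.le_sqrt_of_sq_le
  nlinarith [sq_nonneg (a * y - b * x), mul_le_mul_of_nonneg_right h
    (add_nonneg (sq_nonneg x) (sq_nonneg y))]

/-- Half of the surface area is bounded below by an affine function of `A`, where `r` is the
distance of `(x₂, y₂)` from the origin, `w ^ 2 = 1 + r ^ 2` and `n ^ 2 = 2 * w + 1`. -/
theorem affine_le_sum_sqrt {x₁ x₂ x₃ y₁ y₂ r w n : ℝ} (hr : 0 < r) (hw : 0 < w)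
    (hr2 : r ^ 2 = x₂ ^ 2 + y₂ ^ 2) (hw2 : w ^ 2 = 1 + r ^ 2) (hn2 : n ^ 2 = 2 * w + 1) :
    n * r / (w + 1) + w / r * (x₂ * y₁ - x₁ * y₂ + x₃ * y₂) ≤
      √(x₁ ^ 2 + y₁ ^ 2) +
      √((x₁ - x₂) ^ 2 + (y₁ - y₂) ^ 2 + (x₂ * y₁ - x₁ * y₂) ^ 2) +
      √(y₂ ^ 2 + (x₃ - x₂) ^ 2 + x₃ ^ 2 * y₂ ^ 2) := by
  have hunit : (n / (w + 1)) ^ 2 + (w / (w + 1)) ^ 2 ≤ 1 := by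
    rw [div_pow, div_pow, ← add_div, div_le_one (by positivity)]
    linarith
  -- coordinates of `(x₁, y₁)` along and perpendicular to `(x₂, y₂)`
  set s := (x₁ * x₂ + y₁ * y₂) / r with hs
  set h := (x₂ * y₁ - x₁ * y₂) / r with hh
  have hsr : s * r = x₁ * x₂ + y₁ * y₂ := div_mul_cancel₀ _ hr.ne'
  have hhr : h * r = x₂ * y₁ - x₁ * y₂ := div_mul_cancel₀ _ hr.ne'
  have hrot : s ^ 2 + h ^ 2 = x₁ ^ 2 + y₁ ^ 2 := by
    rw [hs, hh, div_pow, div_pow, ← add_div, div_eq_iff (by positivity), hr2]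
    ring
  have h₁ := add_mul_le_sqrt_of_sq_add_sq_le_one hunit s h
  have h₂ := add_mul_le_sqrt_of_sq_add_sq_le_one hunit (r - s) (w * h)
  rw [hrot] at h₁
  have e₂ : (r - s) ^ 2 + (w * h) ^ 2 =
      (x₁ - x₂) ^ 2 + (y₁ - y₂) ^ 2 + (x₂ * y₁ - x₁ * y₂) ^ 2 := by
    rw [← hhr]
    linear_combination hrot + hr2 - 2 * hsr + h ^ 2 * hw2
  rw [e₂] at h₂
  have h₃ : w / r * (x₃ * y₂) ≤ √(y₂ ^ 2 + (x₃ - x₂) ^ 2 + x₃ ^ 2 * y₂ ^ 2) := by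
    apply Real.le_sqrt_of_sq_le
    rw [mul_pow, div_pow, div_mul_eq_mul_div, div_le_iff₀ (by positivity), hw2, hr2]
    nlinarith [sq_nonneg (x₂ * (x₃ - x₂) - y₂ ^ 2)]
  have e₁ : n * r / (w + 1) + w / r * (x₂ * y₁ - x₁ * y₂) =
      n / (w + 1) * s + w / (w + 1) * h +
        (n / (w + 1) * (r - s) + w / (w + 1) * (w * h)) := by
    rw [← hhr]
    field_simp
    ring
  linarith [mul_add (w / r) (x₂ * y₁ - x₁ * y₂) (x₃ * y₂)]

theorem le_affine_of_poly {r w n a s : ℝ} (hr : 0 < r) (hw : 0 < w) (hn : 0 ≤ n)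
    (hw2 : w ^ 2 = 1 + r ^ 2) (hn2 : n ^ 2 = 2 * w + 1) (ha : 0 ≤ a)
    (h : s ^ 2 * ((n ^ 2 - 3) * (n ^ 2 + 1)) ≤ ((n ^ 2 - 3) * n + (n ^ 2 - 1) * a) ^ 2) :
    s ≤ n * r / (w + 1) + w / r * a := by
  have hw1 : 1 < w := by nlinarith
  have key : s * r ≤ n * (w - 1) + w * a := by
    refine le_of_sq_le_sq ?_ 
      (add_nonneg (mul_nonneg hn (sub_nonneg.2 hw1.le)) (mul_nonneg hw.le ha))
    rw [hn2] at h
    nlinarith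
  have e : n * r / (w + 1) + w / r * a = (n * (w - 1) + w * a) / r := by
    have : r ^ 2 = (w - 1) * (w + 1) := by linarith
    field_simp
    rw [this]
    ring
  rw [e, le_div_iff₀ hr]
  exact key

theorem le_of_chord {a b u v A c₀ c₁ : ℝ} (hab : a < b) (hu : u ≤ c₀ + c₁ * a)
    (hv : v ≤ c₀ + c₁ * b) (haA : a ≤ A) (hAb : A ≤ b) :
    u + (v - u) / (b - a) * (A - a) ≤ c₀ + c₁ * A := by
  have hba : 0 < b - a := sub_pos.2 hab
  rw [← sub_nonneg]
  have e : c₀ + c₁ * A - (u + (v - u) / (b - a) * (A - a)) =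
      ((b - A) * (c₀ + c₁ * a - u) + (A - a) * (c₀ + c₁ * b - v)) / (b - a) := by
    field_simp
    ring
  rw [e]
  exact div_nonneg (add_nonneg (mul_nonneg (sub_nonneg.2 hAb) (sub_nonneg.2 hu))
    (mul_nonneg (sub_nonneg.2 haA) (sub_nonneg.2 hv))) hba.le

theorem lt_of_le_of_lt_cube {L T A : ℝ} (hL : 0 ≤ L) (hLT : L ≤ T)
    (h : 3.44 + 188 * (2 / 3 * A) ^ 2 < (2 * L) ^ 3) :
    3.44 < (2 * T) ^ 3 - 188 * (2 / 3 * A) ^ 2 := by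
  have := pow_le_pow_left₀ (by positivity : 0 ≤ 2 * L) (by linarith : 2 * L ≤ 2 * T) 3
  linarith

theorem lt_cube_sub_sq_of_affine {c₀ c₁ A T : ℝ} (slope : 1 ≤ c₁)
    (h0 : 1.29946475 ≤ c₀ + c₁ * 0.411)    (h1 : 1.6215 ≤ c₀ + c₁ * 0.6)
    (h2 : 2.08 ≤ c₀ + c₁ * 0.9)    (h3 : 2.771 ≤ c₀ + c₁ * 1.4)
    (h4 : 4.03 ≤ c₀ + c₁ * 2.4)    (h5 : 5.9 ≤ c₀ + c₁ * 4)
    (hA : 0.411 ≤ A) (hT : c₀ + c₁ * A ≤ T) :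
    3.44 < (2 * T) ^ 3 - 188 * (2 / 3 * A) ^ 2 := by
  rcases le_total A 0.6 with hA0 | hA0
  · have hL := le_of_chord (by norm_num) h0 h1 hA hA0
    norm_num at hL
    refine lt_of_le_of_lt_cube ?_ (hL.trans hT) ?_
    · linarith
    · nlinarith [mul_nonneg (sub_nonneg.2 hA) (sub_nonneg.2 hA0),
        mul_nonneg (mul_nonneg (sub_nonneg.2 hA) (sub_nonneg.2 hA0)) (sub_nonneg.2 hA0),
        mul_nonneg (mul_nonneg (sub_nonneg.2 hA) (sub_nonneg.2 hA0)) (sub_nonneg.2 hA)]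
  rcases le_total A 0.9 with hA1 | hA1
  · have hL := le_of_chord (by norm_num) h1 h2 hA0 hA1
    norm_num at hL
    refine lt_of_le_of_lt_cube ?_ (hL.trans hT) ?_
    · linarith
    · nlinarith [sq_nonneg (A - 0.742), mul_nonneg (sub_nonneg.2 hA0) (sq_nonneg (A - 0.742))]
  rcases le_total A 1.4 with hA2 | hA2
  · have hL := le_of_chord (by norm_num) h2 h3 hA1 hA2
    norm_num at hL
    refine lt_of_le_of_lt_cube ?_ (hL.trans hT) ?_
    · linarith
    · nlinarith [sq_nonneg (A - 1.093), mul_nonneg (sub_nonneg.2 hA1) (sq_nonneg (A - 1.093))]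
  rcases le_total A 2.4 with hA3 | hA3
  · have hL := le_of_chord (by norm_num) h3 h4 hA2 hA3
    norm_num at hL
    refine lt_of_le_of_lt_cube ?_ (hL.trans hT) ?_
    · linarith
    · nlinarith [sq_nonneg (A - 1.442), mul_nonneg (sub_nonneg.2 hA2) (sq_nonneg (A - 1.442))]
  rcases le_total A 4 with hA4 | hA4
  · have hL := le_of_chord (by norm_num) h4 h5 hA3 hA4
    norm_num at hL
    refine lt_of_le_of_lt_cube ?_ (hL.trans hT) ?_
    · linarith
    · nlinarith [pow_nonneg (sub_nonneg.2 hA3) 3, sq_nonneg (A - 2.4)]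
  · have hL : 5.9 + (A - 4) ≤ c₀ + c₁ * A := by
      linarith [mul_le_mul_of_nonneg_right slope (sub_nonneg.2 hA4)]
    refine lt_of_le_of_lt_cube ?_ (hL.trans hT) ?_
    · linarith
    · nlinarith [pow_nonneg (sub_nonneg.2 hA4) 3, sq_nonneg (A - 4)]

theorem lt_cube_sub_sq {r w n A T : ℝ} (hr : 0 < r) (hw : 0 < w) (hn : 0 ≤ n)
    (hw2 : w ^ 2 = 1 + r ^ 2) (hn2 : n ^ 2 = 2 * w + 1) (hA : 0.411 ≤ A)
    (hT : n * r / (w + 1) + w / r * A ≤ T) :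
    3.44 < (2 * T) ^ 3 - 188 * (2 / 3 * A) ^ 2 := by
  have slope : 1 ≤ w / r := by
    rw [one_le_div hr]
    nlinarith
  have bound (a s : ℝ) := @le_affine_of_poly r w n a s hr hw hn hw2 hn2
  have sq (m : ℝ) (k : ℕ) : 0 ≤ n ^ k * (n - m) ^ 2 :=
    mul_nonneg (pow_nonneg hn k) (sq_nonneg (n - m))
  refine lt_cube_sub_sq_of_affine slope (bound _ _ (by norm_num) ?_) (bound _ _ (by norm_num) ?_)
    (bound _ _ (by norm_num) ?_) (bound _ _ (by norm_num) ?_) (bound _ _ (by norm_num) ?_)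
    (bound _ _ (by norm_num) ?_) hA hT
  · nlinarith [sq 1.84268 0, sq 1.84268 1, sq 1.84268 2, sq 1.84268 3, sq 1.84268 4]
  · nlinarith [sq 1.8823 0, sq 1.8823 1, sq 1.8823 2, sq 1.8823 3, sq 1.8823 4]
  · nlinarith [sq 1.9367 0, sq 1.9367 1, sq 1.9367 2, sq 1.9367 3, sq 1.9367 4]
  · nlinarith [sq 2.0121 0, sq 2.0121 1, sq 2.0121 2, sq 2.0121 3, sq 2.0121 4]
  · nlinarith [sq 2.1296 0, sq 2.1296 1, sq 2.1296 2, sq 2.1296 3, sq 2.1296 4]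
  · nlinarith [sq 2.269 0, sq 2.269 1, sq 2.269 2, sq 2.269 3, sq 2.269 4]

theorem stmt_16 (x₁ x₂ x₃ y₁ y₂ : ℝ)
    (hx₁ : 0 ≤ x₁) (hx₁₂ : x₁ ≤ x₂) (hx₂₃ : x₂ ≤ x₃) (hx₃ : x₃ ≤ 6.5)
    (hy₁0 : 0 ≤ y₁) (hy₁ : y₁ ≤ 6.5) (hy₂0 : 0 ≤ y₂) (hy₂ : y₂ ≤ 6.5)
    (h1 : 0 ≤ x₂ * y₁ - x₁ * y₂)
    (h2 : 0 ≤ (x₃ - x₁) * y₂ - (x₃ - x₂) * y₁)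
    (h3 : 0.411 ≤ x₂ * y₁ - x₁ * y₂ + x₃ * y₂)
    (S V : ℝ)
    (hS : S = 2 * Real.sqrt (x₁ ^ 2 + y₁ ^ 2) +
      2 * Real.sqrt ((x₁ - x₂) ^ 2 + (y₁ - y₂) ^ 2 + (x₂ * y₁ - x₁ * y₂) ^ 2) +
      2 * Real.sqrt (y₂ ^ 2 + (x₃ - x₂) ^ 2 + x₃ ^ 2 * y₂ ^ 2))
    (hV : V = 2 / 3 * (x₂ * y₁ - x₁ * y₂ + x₃ * y₂)) :
    3.44 < S ^ 3 - 188 * V ^ 2 := by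
  set A := x₂ * y₁ - x₁ * y₂ + x₃ * y₂ with hA
  have hpos : 0 < x₂ ^ 2 + y₂ ^ 2 := by
    by_contra! hle
    have hx : x₂ = 0 := by nlinarith [sq_nonneg x₂, sq_nonneg y₂]
    have hy : y₂ = 0 := by nlinarith [sq_nonneg x₂, sq_nonneg y₂]
    rw [hA, hx, hy] at h3
    norm_num at h3
  have hr : 0 < √(x₂ ^ 2 + y₂ ^ 2) := Real.sqrt_pos.2 hpos
  have hr2 : √(x₂ ^ 2 + y₂ ^ 2) ^ 2 = x₂ ^ 2 + y₂ ^ 2 := Real.sq_sqrt hpos.le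
  generalize √(x₂ ^ 2 + y₂ ^ 2) = r at hr hr2
  have hw : 0 < √(1 + r ^ 2) := Real.sqrt_pos.2 (by positivity)
  have hw2 : √(1 + r ^ 2) ^ 2 = 1 + r ^ 2 := Real.sq_sqrt (by positivity)
  generalize √(1 + r ^ 2) = w at hw hw2
  have hn2 : √(2 * w + 1) ^ 2 = 2 * w + 1 := Real.sq_sqrt (by positivity)
  have := lt_cube_sub_sq hr hw (Real.sqrt_nonneg _) hw2 hn2 h3
    (affine_le_sum_sqrt (x₁ := x₁) (x₃ := x₃) (y₁ := y₁) hr hw hr2 hw2 hn2)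
  rw [hS, hV]
  convert this using 2
  ring
end
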